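/- Let n be a positive integer with n ≡ 2 (mod 6), H a finite abelian group of order n²+n+1, and T₀, T₁ inverse-closed subsets of H with e ∈ T₀ and |T₀| + |T₁| = 2n+1 satisfying the APLL group-ring equations. Let ℓ₀ = |T₁ ∩ {t³ : t ∈ T₀}|, u = |T₀ ∩ {t³ : t ∈ T₁}| + |T₁ ∩ {t³ : t ∈ T₁}|, and for i ≥ 5 let s_i = (i−1)(i−4)/2 if i ≡ 1 (mod 3) and s_i = (i−2)(i−3)/2 otherwise. Then, as inequalities of rational numbers: 3|X₀| ≤ n − 2ℓ₀ − θ₀; Σ_{i≥5} s_i·|X_i| ≤ n − 2ℓ₀ − θ₀; 3|Y₀| ≤ n − 2u + 3 − θ₁; Σ_{i≥5} s_i·|Y_i| ≤ n − 2u + 3 − θ₁; n² − 4n + 7ℓ₀ + 2θ₀ ≤ 3|X₄| ≤ n² − n + ℓ₀ − θ₀; 2n² − 6n + 7ℓ₀ + 3 + 2θ₀ ≤ 3|X₁| ≤ 2n² − 2n − ℓ₀ + 3 − 2θ₀; n² − 6n + 7u − 8 + 2θ₁ ≤ 3|Y₄| ≤ n² − 3n + u + 1 − θ₁; and 2n²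 − 4n + 7u − 4 + 2θ₁ ≤ 3|Y₁| ≤ 2n² − u + 8 − 2θ₁. -/

import Mathlib

open scoped Classical Pointwise

/-- The APLL group-ring equations, stated via coefficient counts: for every `h ∈ H`,
`#{(a,b) ∈ T₀×T₁ : ab = h} = 1 − [h = e]`, and
`#{(a,b) ∈ T₀×T₀ : ab = h} + #{(a,b) ∈ T₁×T₁ : ab = h} + #{t ∈ T₀ : t² = h}
  + #{t ∈ T₁ : t² = h} = 2 + 2n·[h = e]`. -/
def APLLEqs {H : Type*} [CommGroup H] (n : ℕ) (T₀ T₁ : Set H) : Prop :=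
  (∀ h : H,
      {p : H × H | p.1 ∈ T₀ ∧ p.2 ∈ T₁ ∧ p.1 * p.2 = h}.ncard
        = if h = 1 then 0 else 1) ∧
  (∀ h : H,
      {p : H × H | p.1 ∈ T₀ ∧ p.2 ∈ T₀ ∧ p.1 * p.2 = h}.ncard
        + {p : H × H | p.1 ∈ T₁ ∧ p.2 ∈ T₁ ∧ p.1 * p.2 = h}.ncard
        + {t : H | t ∈ T₀ ∧ t ^ 2 = h}.ncard
        + {t : H | t ∈ T₁ ∧ t ^ 2 = h}.ncard
        = 2 + if h = 1 then 2 * n else 0)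

/-- `Xset T₀ T₁ i` is the set of `h ∈ H` appearing with coefficient `i` in `T̂⁽²⁾T₀`. -/
def Xset {H : Type*} [CommGroup H] (T₀ T₁ : Set H) (i : ℕ) : Set H :=
  {h : H | {p : H × H | p.1 ∈ T₀ ∪ T₁ ∧ p.2 ∈ T₀ ∧ p.1 ^ 2 * p.2 = h}.ncard = i}

/-- `Yset T₀ T₁ i` is the set of `h ∈ H` appearing with coefficient `i` in `T̂⁽²⁾T₁`. -/
def Yset {H : Type*} [CommGroup H] (T₀ T₁ : Set H) (i : ℕ) : Set H :=
  {h : H | {p : H × H | p.1 ∈ T₀ ∪ T₁ ∧ p.2 ∈ T₁ ∧ p.1 ^ 2 * p.2 = h}.ncard = i}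

/-- `Vset T₀ T₁ i` is the set of `h ∈ H` appearing with coefficient `i` in `T̂⁽⁴⁾T₁`. -/
def Vset {H : Type*} [CommGroup H] (T₀ T₁ : Set H) (i : ℕ) : Set H :=
  {h : H | {p : H × H | p.1 ∈ T₀ ∪ T₁ ∧ p.2 ∈ T₁ ∧ p.1 ^ 4 * p.2 = h}.ncard = i}

/-- `θ₀ = |(T₀T₀ ∖ T₀⁽²⁾) ∩ T̂⁽⁴⁾|`. -/
noncomputable def theta0 {H : Type*} [CommGroup H] (T₀ T₁ : Set H) : ℕ :=
  (((T₀ * T₀) \ ((fun t => t ^ 2) '' T₀)) ∩ ((fun g => g ^ 4) '' (T₀ ∪ T₁))).ncard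

/-- `θ₁ = |T₁ ∩ T̂⁽²⁾|/2 + |(T₁T₁ ∖ (T₁⁽²⁾ ∪ {e})) ∩ T̂⁽⁴⁾|`, as a rational number. -/
noncomputable def theta1 {H : Type*} [CommGroup H] (T₀ T₁ : Set H) : ℚ :=
  ((T₁ ∩ ((fun g => g ^ 2) '' (T₀ ∪ T₁))).ncard : ℚ) / 2
    + ((((T₁ * T₁) \ (((fun t => t ^ 2) '' T₁) ∪ {1}))
        ∩ ((fun g => g ^ 4) '' (T₀ ∪ T₁))).ncard : ℚ)

/-- `s_i = (i−1)(i−4)/2` if `i ≡ 1 (mod 3)`, and `(i−2)(i−3)/2` otherwise. -/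
def sCoef (i : ℕ) : ℚ :=
  if i % 3 = 1 then ((i : ℚ) - 1) * ((i : ℚ) - 4) / 2
  else ((i : ℚ) - 2) * ((i : ℚ) - 3) / 2


section Counting

variable {H : Type*} [Fintype H]

/-- The residue class representative of `i` modulo `3` in `{1, 2, 3}`. -/
def residueOneToThree (i : ℕ) : ℚ :=
  if i % 3 = 1 then 1 else if i % 3 = 2 then 2 else 3

lemma sCoef_eq (i : ℕ) :
    sCoef i = ((i : ℚ) ^ 2 - 5 * i + 4) / 2
      + ((if i % 3 = 0 then 1 else 0) + (if i % 3 = 2 then 1 else 0)) := by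
  have h : i % 3 < 3 := Nat.mod_lt _ (by norm_num)
  unfold sCoef
  interval_cases i % 3 <;> norm_num <;> ring

lemma sCoef_nonneg (i : ℕ) : 0 ≤ sCoef i := by
  unfold sCoef
  by_cases h5 : 5 ≤ i
  · have : (5 : ℚ) ≤ i := by exact_mod_cast h5
    split_ifs <;> apply div_nonneg <;> nlinarith
  · interval_cases i <;> norm_num

lemma residue_excess_le_two_mul_sCoef {i : ℕ} (hi : 5 ≤ i) :
    (i : ℚ) - residueOneToThree i ≤ 2 * sCoef i := by
  unfold residueOneToThree sCoef
  rcases eq_or_ne i 5 with rfl | h5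
  · norm_num
  · have : (6 : ℚ) ≤ i := by exact_mod_cast (show 6 ≤ i by omega)
    split_ifs <;> nlinarith

lemma residueOneToThree_le {i : ℕ} (hi : 1 ≤ i) : residueOneToThree i ≤ i := by
  have : residueOneToThree i ≤ ((if i % 3 = 1 then 1 else if i % 3 = 2 then 2 else 3 : ℕ) : ℚ) := by
    unfold residueOneToThree
    split_ifs <;> norm_num
  refine this.trans ?_
  norm_cast
  split_ifs <;> omega

lemma residueOneToThree_add_three_le {i : ℕ} (hi : 5 ≤ i) : residueOneToThree i + 3 ≤ i := by
  have h := residueOneToThree_le (i := i - 3) (by omega)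
  have e : residueOneToThree (i - 3) = residueOneToThree i := by
    unfold residueOneToThree
    rw [show (i - 3) % 3 = i % 3 by omega]
  rw [e, Nat.cast_sub (by omega)] at h
  norm_num at h
  linarith

lemma tsum_sCoef_mul_ncard (f : H → ℕ) :
    (∑' i : ℕ, if 5 ≤ i then sCoef i * (({h | f h = i} : Set H).ncard : ℚ) else 0)
      = ∑ h, if 5 ≤ f h then sCoef (f h) else 0 := by
  rw [Finset.sum_comp (fun i => if 5 ≤ i then sCoef i else 0) f,
    tsum_eq_sum (s := Finset.univ.image f)]
  · refine Finset.sum_congr rfl fun i _ => ?_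
    rw [Set.ncard_eq_toFinset_card', nsmul_eq_mul, Set.toFinset_ofPred]
    split_ifs
    · ring
    · simp
  · intro i hi
    have : ({h | f h = i} : Set H) = ∅ := by
      ext h
      simp only [Set.mem_ofPred_eq, Set.mem_empty_iff_false, iff_false]
      rintro rfl
      exact hi (Finset.mem_image_of_mem f (Finset.mem_univ h))
    simp [this]

lemma cast_ncard_setOf (p : H → Prop) :
    (({h | p h} : Set H).ncard : ℚ) = ∑ h, if p h then 1 else 0 := by
  rw [Set.ncard_eq_toFinset_card', Set.toFinset_ofPred, Finset.sum_boole]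

/-- Bounds on the level sets of `f` in terms of `K = ∑ h, sCoef (f h)`, of
`R = ∑ h, (f h - r (f h))`, where `r i` is the residue of `i` in `{1, 2, 3}` modulo `3`, and of
the number `N₁` of `h` with `f h ≡ 1` modulo `3`. -/
lemma level_set_bounds (f : H → ℕ) {K R N₁ : ℚ} (hK : ∑ h, sCoef (f h) = K)
    (hR : ∑ h, ((f h : ℚ) - residueOneToThree (f h)) = R)
    (hN : ∑ h, (if f h % 3 = 1 then (1 : ℚ) else 0) = N₁) :
    3 * (({h | f h = 0} : Set H).ncard : ℚ) ≤ K ∧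
    (∑' i : ℕ, if 5 ≤ i then sCoef i * (({h | f h = i} : Set H).ncard : ℚ) else 0) ≤ K ∧
    (R - 2 * K ≤ 3 * (({h | f h = 4} : Set H).ncard : ℚ) ∧
      3 * (({h | f h = 4} : Set H).ncard : ℚ) ≤ R + K) ∧
    (3 * N₁ - R - 2 * K ≤ 3 * (({h | f h = 1} : Set H).ncard : ℚ) ∧
      3 * (({h | f h = 1} : Set H).ncard : ℚ) ≤ 3 * N₁ - R + 2 * K) := by
  rw [tsum_sCoef_mul_ncard]
  simp only [cast_ncard_setOf, ← hK, ← hR, ← hN, Finset.mul_sum, ← Finset.sum_sub_distrib,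
    ← Finset.sum_add_distrib]
  refine ⟨?_, ?_, ⟨?_, ?_⟩, ?_, ?_⟩ <;> refine Finset.sum_le_sum fun h _ => ?_ <;>
    generalize f h = i <;> by_cases hi : 5 ≤ i
  all_goals
    first
    | have h1 := sCoef_nonneg i
      have h2 := residue_excess_le_two_mul_sCoef hi
      have h3 := residueOneToThree_add_three_le hi
      simp only [show ¬ i = 0 by omega, show ¬ i = 1 by omega, show ¬ i = 4 by omega, hi,
        if_true, if_false]
      try split_ifs
      all_goals linarith
    | have hi' : i < 5 := by omega
      interval_cases i <;> norm_num [sCoef, residueOneToThree]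

/-- The level set bounds in terms of the first two moments of `f` and its residues modulo `3`. -/
lemma level_set_bounds_of_moments (f : H → ℕ) {S₁ S₂ N₀ N₂ : ℚ}
    (hS₁ : ∑ h, (f h : ℚ) = S₁) (hS₂ : ∑ h, (f h : ℚ) ^ 2 = S₂)
    (hN₀ : ∑ h, (if f h % 3 = 0 then (1 : ℚ) else 0) = N₀)
    (hN₂ : ∑ h, (if f h % 3 = 2 then (1 : ℚ) else 0) = N₂)
    {K R N₁ : ℚ} (hN₁ : N₁ = Fintype.card H - N₀ - N₂)
    (hK : K = (S₂ - 5 * S₁ + 4 * Fintype.card H) / 2 + (N₀ + N₂))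
    (hR : R = S₁ - (N₁ + 2 * N₂ + 3 * N₀)) :
    3 * (({h | f h = 0} : Set H).ncard : ℚ) ≤ K ∧
    (∑' i : ℕ, if 5 ≤ i then sCoef i * (({h | f h = i} : Set H).ncard : ℚ) else 0) ≤ K ∧
    (R - 2 * K ≤ 3 * (({h | f h = 4} : Set H).ncard : ℚ) ∧
      3 * (({h | f h = 4} : Set H).ncard : ℚ) ≤ R + K) ∧
    (3 * N₁ - R - 2 * K ≤ 3 * (({h | f h = 1} : Set H).ncard : ℚ) ∧
      3 * (({h | f h = 1} : Set H).ncard : ℚ) ≤ 3 * N₁ - R + 2 * K) := by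
  have hN : ∑ h, (if f h % 3 = 1 then (1 : ℚ) else 0) = N₁ := by
    rw [hN₁, ← hN₀, ← hN₂, Fintype.card_eq_sum_ones, Nat.cast_sum, ← Finset.sum_sub_distrib,
      ← Finset.sum_sub_distrib]
    refine Finset.sum_congr rfl fun h _ => ?_
    have : f h % 3 < 3 := Nat.mod_lt _ (by norm_num)
    interval_cases f h % 3 <;> norm_num
  refine level_set_bounds f ?_ ?_ hN
  · rw [hK, ← hS₁, ← hS₂, ← hN₀, ← hN₂, Fintype.card_eq_sum_ones, Nat.cast_sum, Finset.mul_sum,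
      Finset.mul_sum, ← Finset.sum_sub_distrib, ← Finset.sum_add_distrib,
      ← Finset.sum_add_distrib, Finset.sum_div, ← Finset.sum_add_distrib]
    refine Finset.sum_congr rfl fun h _ => ?_
    rw [sCoef_eq]
    norm_num
  · rw [hR, ← hN, ← hS₁, ← hN₀, ← hN₂, Finset.mul_sum, Finset.mul_sum,
      ← Finset.sum_add_distrib, ← Finset.sum_add_distrib, ← Finset.sum_sub_distrib]
    refine Finset.sum_congr rfl fun h _ => ?_
    have : f h % 3 < 3 := Nat.mod_lt _ (by norm_num)
    unfold residueOneToThree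
    interval_cases f h % 3 <;> norm_num

end Counting

section GroupRing

open MonoidAlgebra Finset

variable {H : Type*} [CommGroup H]

/-- The element of the group ring `R[H]` given by the sum of the elements of a finite set. -/
noncomputable def groupRingSum (R : Type*) [CommRing R] (S : Finset H) : MonoidAlgebra R H :=
  ∑ s ∈ S, single s 1

variable {R : Type*} [CommRing R]

omit [CommGroup H] in
lemma coeff_sum_single {ι : Type*} (P : Finset ι) (φ : ι → H) (h : H) :
    (∑ x ∈ P, single (φ x) (1 : R)).coeff h = #{x ∈ P | φ x = h} := by
  rw [coeff_sum, Finsupp.finsetSum_apply]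
  simp [Finsupp.single_apply]

omit [CommGroup H] in
lemma coeff_groupRingSum (S : Finset H) (h : H) :
    (groupRingSum R S).coeff h = if h ∈ S then 1 else 0 := by
  simp [groupRingSum, coeff_sum, Finsupp.single_apply]

lemma groupRingSum_mul (S T : Finset H) :
    groupRingSum R S * groupRingSum R T = ∑ p ∈ S ×ˢ T, single (p.1 * p.2) 1 := by
  simp [groupRingSum, Finset.sum_mul_sum, Finset.sum_product, single_mul_single]

lemma coeff_groupRingSum_mul (S T : Finset H) (h : H) :
    (groupRingSum R S * groupRingSum R T).coeff h = #{p ∈ S ×ˢ T | p.1 * p.2 = h} := by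
  rw [groupRingSum_mul, coeff_sum_single]

lemma coeff_one_groupRingSum_mul (S : Finset H) (x : MonoidAlgebra R H) :
    (groupRingSum R S * x).coeff 1 = ∑ s ∈ S, x.coeff s⁻¹ := by
  rw [groupRingSum, Finset.sum_mul, coeff_sum, Finsupp.finsetSum_apply]
  simp

lemma coeff_one_mul_eq_sum [Fintype H] (x y : MonoidAlgebra R H) :
    (x * y).coeff 1 = ∑ h, x.coeff h * y.coeff h⁻¹ := by
  rw [coeff_mul_apply_left, Finsupp.sum_fintype _ _ (by simp)]
  simp

lemma groupRingSum_mul_univ [Fintype H] (S : Finset H) :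
    groupRingSum R S * groupRingSum R univ = (#S : MonoidAlgebra R H) * groupRingSum R univ := by
  have h (s : H) : single s (1 : R) * groupRingSum R univ = groupRingSum R univ := by
    ext h
    simp [coeff_groupRingSum]
  rw [groupRingSum, Finset.sum_mul, Finset.sum_congr rfl fun s _ => h s]
  simp

lemma mapDomainRingHom_groupRingSum {φ : H →* H} (hφ : Function.Injective φ) (S : Finset H) :
    mapDomainRingHom R φ (groupRingSum R S) = groupRingSum R (S.image φ) := by
  rw [groupRingSum, groupRingSum, map_sum, Finset.sum_image hφ.injOn]
  refine Finset.sum_congr rfl fun s _ => ?_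
  simp [mapDomainRingHom]

lemma groupRingSum_pow_char (p : ℕ) [Fact p.Prime] (hp : Function.Injective fun h : H => h ^ p)
    (S : Finset H) :
    groupRingSum (ZMod p) S ^ p = groupRingSum (ZMod p) (S.image fun h => h ^ p) := by
  have : CharP (MonoidAlgebra (ZMod p) H) p :=
    charP_of_injective_algebraMap (algebraMap (ZMod p) (MonoidAlgebra (ZMod p) H)).injective p
  rw [groupRingSum, groupRingSum, sum_pow_char, Finset.sum_image hp.injOn]
  refine Finset.sum_congr rfl fun s _ => ?_
  simp [single_pow]

lemma groupRingSum_image_mul {φ : H → H} {S : Finset H} (hφ : Set.InjOn φ S) (T : Finset H) :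
    groupRingSum R (S.image φ) * groupRingSum R T = ∑ p ∈ S ×ˢ T, single (φ p.1 * p.2) 1 := by
  simp [groupRingSum, Finset.sum_image hφ, Finset.sum_mul_sum, Finset.sum_product,
    single_mul_single]

lemma groupRingSum_union {S T : Finset H} (h : Disjoint S T) :
    groupRingSum R (S ∪ T) = groupRingSum R S + groupRingSum R T :=
  Finset.sum_union h

end GroupRing

section APLLPair

open MonoidAlgebra Finset

variable {H : Type*} [CommGroup H] [Fintype H]

omit [Fintype H] in
lemma two_le_card_mul_eq {P : Finset H} {a b h : H} (ha : a ∈ P) (hb : b ∈ P) (hab : a ≠ b)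
    (h_eq : a * b = h) : 2 ≤ #{p ∈ P ×ˢ P | p.1 * p.2 = h} := by
  refine Finset.one_lt_card.2 ⟨(a, b), ?_, (b, a), ?_, by simp [hab]⟩
  · simp [ha, hb, h_eq]
  · simp [ha, hb, mul_comm b, h_eq]

/-- A pair of inverse-closed finite sets satisfying the APLL equations, where `n ≡ 2` modulo `6`.
Unlike in `APLLEqs`, the two sets play symmetric roles. -/
structure IsAPLLPair (n : ℕ) (P Q : Finset H) : Prop where
  mod_six : n % 6 = 2
  card_group : Fintype.card H = n ^ 2 + n + 1
  card_add_card : #P + #Q = 2 * n + 1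
  inv_mem_left : ∀ x ∈ P, x⁻¹ ∈ P
  inv_mem_right : ∀ x ∈ Q, x⁻¹ ∈ Q
  card_mul : ∀ h, #{p ∈ P ×ˢ Q | p.1 * p.2 = h} = if h = 1 then 0 else 1
  card_mul_self : ∀ h, #{p ∈ P ×ˢ P | p.1 * p.2 = h} + #{p ∈ Q ×ˢ Q | p.1 * p.2 = h}
    + (if h ∈ P.image (fun t => t ^ 2) then 1 else 0)
    + (if h ∈ Q.image (fun t => t ^ 2) then 1 else 0) = 2 + if h = 1 then 2 * n else 0

namespace IsAPLLPair

variable {n : ℕ} {P Q : Finset H}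

lemma symm (hPQ : IsAPLLPair n P Q) : IsAPLLPair n Q P where
  mod_six := hPQ.mod_six
  card_group := hPQ.card_group
  card_add_card := by rw [add_comm, hPQ.card_add_card]
  inv_mem_left := hPQ.inv_mem_right
  inv_mem_right := hPQ.inv_mem_left
  card_mul h := by
    rw [← hPQ.card_mul h]
    refine Finset.card_nbij' Prod.swap Prod.swap ?_ ?_
      (fun _ _ => rfl) (fun _ _ => rfl) <;>
      · rintro ⟨a, b⟩
        simp +contextual [mul_comm]
  card_mul_self h := by
    rw [← hPQ.card_mul_self h]
    ring

lemma disjoint (hPQ : IsAPLLPair n P Q) : Disjoint P Q := by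
  rw [Finset.disjoint_left]
  intro x hxP hxQ
  have h := hPQ.card_mul 1
  rw [if_pos rfl, Finset.card_eq_zero, Finset.filter_eq_empty_iff] at h
  exact h (Finset.mk_mem_product hxP (hPQ.inv_mem_right x hxQ)) (mul_inv_cancel x)

lemma inv_mem_union (hPQ : IsAPLLPair n P Q) {x : H} (hx : x ∈ P ∪ Q) : x⁻¹ ∈ P ∪ Q := by
  rw [Finset.mem_union] at hx ⊢
  exact hx.imp (hPQ.inv_mem_left x) (hPQ.inv_mem_right x)

lemma coprime_six (hPQ : IsAPLLPair n P Q) : (Nat.card H).Coprime 6 := by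
  rw [Nat.card_eq_fintype_card, hPQ.card_group, Nat.coprime_iff_gcd_eq_one, Nat.gcd_comm,
    Nat.gcd_rec]
  have : (n ^ 2 + n + 1) % 6 = 1 := by simp [Nat.add_mod, Nat.pow_mod, hPQ.mod_six]
  rw [this, Nat.gcd_one_left]

lemma pow_injective (hPQ : IsAPLLPair n P Q) {k : ℕ} (hk : k ∣ 6 ^ 2) :
    Function.Injective fun h : H => h ^ k :=
  ((hPQ.coprime_six.pow_right 2).coprime_dvd_right hk).pow_left_bijective.injective

lemma card_mul_self_of_mem (hPQ : IsAPLLPair n P Q) {h : H} (h1 : h ≠ 1)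
    (hP : h ∈ P.image fun t => t ^ 2) : #{p ∈ P ×ˢ P | p.1 * p.2 = h} = 1 := by
  have h0 := hPQ.card_mul_self h
  rw [if_pos hP, if_neg h1] at h0
  obtain ⟨y, hy, rfl⟩ := Finset.mem_image.1 hP
  have hpos : 0 < #{p ∈ P ×ˢ P | p.1 * p.2 = y ^ 2} :=
    Finset.card_pos.2 ⟨(y, y), by simp [hy, sq]⟩
  have hQ : ¬ y ^ 2 ∈ Q.image fun t => t ^ 2 := by
    intro hQ
    obtain ⟨z, hz, hzy⟩ := Finset.mem_image.1 hQ
    have := hPQ.pow_injective (k := 2) (by norm_num) hzy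
    subst this
    exact Finset.disjoint_left.1 hPQ.disjoint hy hz
  have hsymm (h : H) (h1 : h ∉ Q.image fun t => t ^ 2) : Even #{p ∈ Q ×ˢ Q | p.1 * p.2 = h} := by
    have : ∑ p ∈ Q ×ˢ Q with p.1 * p.2 = h, (1 : ZMod 2) = 0 := by
      refine Finset.sum_involution (fun p _ => p.swap) ?_ ?_ ?_ ?_
      · intros; decide
      · rintro ⟨a, b⟩ hab - heq
        simp only [Finset.mem_filter, Finset.mem_product, Prod.swap_prod_mk, Prod.mk.injEq]
          at hab heq
        refine h1 (Finset.mem_image.2 ⟨a, hab.1.1, ?_⟩)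
        rw [← hab.2, sq, heq.1]
      · rintro ⟨a, b⟩
        simp +contextual [mul_comm]
      · simp
    rwa [Finset.sum_const, nsmul_eq_mul, mul_one, ZMod.natCast_eq_zero_iff_even] at this
  obtain ⟨k, hk⟩ := hsymm _ hQ
  rw [if_neg hQ] at h0
  omega

lemma card_mul_self_eq (hPQ : IsAPLLPair n P Q) (h : H) :
    #{p ∈ P ×ˢ P | p.1 * p.2 = h} = if h = 1 then #P else
      (if h ∈ P.image (fun t => t ^ 2) then 1 else 0)
        + 2 * if h ∈ (P * P) \ P.image (fun t => t ^ 2) then 1 else 0 := by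
  split_ifs with h1 h2 h3 h3
  · subst h1
    refine Finset.card_nbij' Prod.fst (fun x => (x, x⁻¹)) ?_ ?_ ?_ ?_
    · rintro ⟨a, b⟩
      simp +contextual
    · intro a ha
      simpa using ⟨ha, hPQ.inv_mem_left a ha⟩
    · rintro ⟨a, b⟩ hab
      have hab : a * b = 1 := (Finset.mem_filter.1 hab).2
      exact Prod.ext rfl (inv_eq_of_mul_eq_one_right hab)
    · exact fun _ _ => rfl
  · exact absurd h2 (Finset.mem_sdiff.1 h3).2
  · exact hPQ.card_mul_self_of_mem h1 h2
  · obtain ⟨h3, -⟩ := Finset.mem_sdiff.1 h3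
    obtain ⟨a, ha, b, hb, rfl⟩ := Finset.mem_mul.1 h3
    have hab : a ≠ b := by
      rintro rfl
      exact h2 (Finset.mem_image.2 ⟨a, ha, sq a⟩)
    refine le_antisymm ?_ ?_
    · have := hPQ.card_mul_self (a * b)
      rw [if_neg h1] at this
      omega
    · exact two_le_card_mul_eq ha hb hab rfl
  · rw [Finset.card_eq_zero, Finset.filter_eq_empty_iff]
    rintro ⟨a, b⟩ hab rfl
    rw [Finset.mem_product] at hab
    exact h3 (Finset.mem_sdiff.2 ⟨Finset.mul_mem_mul hab.1 hab.2, h2⟩)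

lemma eq_of_mul_eq_sq (hPQ : IsAPLLPair n P Q) {a b y : H} (ha : a ∈ P) (hb : b ∈ P)
    (hy : y ∈ P ∪ Q) (hy1 : y ≠ 1) (h : a * b = y ^ 2) : a = b := by
  have h1 : y ^ 2 ≠ 1 := by
    intro h1
    exact hy1 (hPQ.pow_injective (k := 2) (by norm_num) (h1.trans (one_pow 2).symm))
  by_contra hab
  have h2 : 2 ≤ #{p ∈ P ×ˢ P | p.1 * p.2 = y ^ 2} :=
    two_le_card_mul_eq ha hb hab h
  rcases Finset.mem_union.1 hy with hy | hy
  · have := hPQ.card_mul_self_of_mem h1 (Finset.mem_image_of_mem _ hy)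
    omega
  · have h3 := hPQ.symm.card_mul_self_of_mem h1 (Finset.mem_image_of_mem _ hy)
    have h4 := hPQ.card_mul_self (y ^ 2)
    rw [h3, if_neg h1, if_pos (Finset.mem_image_of_mem _ hy)] at h4
    omega

lemma eq_one_of_eq_sq (hPQ : IsAPLLPair n P Q) {x y : H} (h1 : 1 ∈ P) (hx : x ∈ P)
    (hy : y ∈ P ∪ Q) (h : x = y ^ 2) : x = 1 := by
  rcases eq_or_ne y 1 with rfl | hy1
  · rw [h, one_pow]
  · exact hPQ.eq_of_mul_eq_sq hx h1 hy hy1 (by rw [mul_one, h])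

lemma eq_one_of_eq_cube (hPQ : IsAPLLPair n P Q) {x y : H} (hx : x ∈ P) (hy : y ∈ P)
    (h : x = y ^ 3) : x = 1 := by
  by_cases hy1 : y = 1
  · rw [h, hy1, one_pow]
  · have h2 := hPQ.eq_of_mul_eq_sq hx (hPQ.inv_mem_left y hy) (Finset.mem_union_left _ hy) hy1
      (by rw [h, pow_succ, mul_inv_cancel_right])
    refine absurd (hPQ.pow_injective (k := 4) (by norm_num) ?_) hy1
    change y ^ 4 = 1 ^ 4
    rw [pow_succ, ← h, h2, inv_mul_cancel, one_pow]

/-- The coefficient of `h` in `(P⁽²⁾ + Q⁽²⁾) P`. -/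
noncomputable def sqCoef (P Q : Finset H) (h : H) : ℕ :=
  #{p ∈ (P ∪ Q) ×ˢ P | p.1 ^ 2 * p.2 = h}

variable {R : Type*} [CommRing R]

lemma groupRingSum_mul_eq (hPQ : IsAPLLPair n P Q) :
    groupRingSum R P * groupRingSum R Q = groupRingSum R univ - 1 := by
  ext h
  rw [coeff_groupRingSum_mul, hPQ.card_mul, coeff_sub, Finsupp.sub_apply, coeff_groupRingSum,
    one_def, coeff_single, Finsupp.single_apply]
  simp only [eq_comm (a := (1 : H)), Finset.mem_univ, if_true]
  split_ifs <;> simp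

lemma groupRingSum_sq_add_sq (hPQ : IsAPLLPair n P Q) :
    groupRingSum R P ^ 2 + groupRingSum R Q ^ 2 + groupRingSum R (P.image fun t => t ^ 2)
      + groupRingSum R (Q.image fun t => t ^ 2)
      = 2 * groupRingSum R univ + 2 * (n : MonoidAlgebra R H) := by
  have e : (2 : MonoidAlgebra R H) * (n : MonoidAlgebra R H) = ((2 * n : ℕ) : MonoidAlgebra R H) := by
    push_cast
    ring
  rw [e, two_mul, sq, sq]
  ext h
  have := congrArg (Nat.cast : ℕ → R) (hPQ.card_mul_self h)
  simp only [coeff_add, Finsupp.add_apply, coeff_groupRingSum_mul, coeff_groupRingSum,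
    coeff_natCast, Finsupp.single_apply, eq_comm (a := (1 : H)), Finset.mem_univ, if_true]
  push_cast at this ⊢
  rw [this]
  norm_num

lemma groupRingSum_image_sq_mul (hPQ : IsAPLLPair n P Q) :
    (groupRingSum R (P.image fun t => t ^ 2) + groupRingSum R (Q.image fun t => t ^ 2))
      * groupRingSum R P
      = (2 * #P - #Q : MonoidAlgebra R H) * groupRingSum R univ
        + 2 * (n : MonoidAlgebra R H) * groupRingSum R P + groupRingSum R Q
        - groupRingSum R P ^ 3 := by
  linear_combination groupRingSum R P * hPQ.groupRingSum_sq_add_sq (R := R)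
    - groupRingSum R Q * hPQ.groupRingSum_mul_eq (R := R) + 2 * groupRingSum_mul_univ (R := R) P
    - groupRingSum_mul_univ (R := R) Q

lemma coeff_groupRingSum_image_sq_mul (hPQ : IsAPLLPair n P Q) (h : H) :
    ((groupRingSum R (P.image fun t => t ^ 2) + groupRingSum R (Q.image fun t => t ^ 2))
      * groupRingSum R P).coeff h = (sqCoef P Q h : R) := by
  have hinj := hPQ.pow_injective (k := 2) (by norm_num)
  rw [← groupRingSum_union ((Finset.disjoint_image hinj).2 hPQ.disjoint), ← Finset.image_union,
    groupRingSum_image_mul hinj.injOn, coeff_sum_single, sqCoef]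

lemma sqCoef_mod_three (hPQ : IsAPLLPair n P Q) (h : H) :
    sqCoef P Q h % 3 = if h ∈ P ∪ Q then (if h ∈ P.image fun t => t ^ 3 then 1 else 2)
      else (if h ∈ P.image fun t => t ^ 3 then 0 else 1) := by
  have hchar : CharP (MonoidAlgebra (ZMod 3) H) 3 :=
    charP_of_injective_algebraMap
      (algebraMap (ZMod 3) (MonoidAlgebra (ZMod 3) H)).injective 3
  have h3 : (3 : MonoidAlgebra (ZMod 3) H) = 0 := by
    exact_mod_cast CharP.cast_eq_zero (MonoidAlgebra (ZMod 3) H) 3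
  obtain ⟨k, hk⟩ : ∃ k, n = 3 * k + 2 := ⟨n / 3, by have := hPQ.mod_six; omega⟩
  have hk' := congrArg (Nat.cast : ℕ → MonoidAlgebra (ZMod 3) H) hk
  have hadd := congrArg (Nat.cast : ℕ → MonoidAlgebra (ZMod 3) H) hPQ.card_add_card
  push_cast at hk' hadd
  have key : (groupRingSum (ZMod 3) (P.image fun t => t ^ 2)
      + groupRingSum (ZMod 3) (Q.image fun t => t ^ 2)) * groupRingSum (ZMod 3) P
      + groupRingSum (ZMod 3) (P.image fun t => t ^ 3)
      = groupRingSum (ZMod 3) univ + groupRingSum (ZMod 3) (P ∪ Q) := by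
    have : Fact (Nat.Prime 3) := ⟨Nat.prime_three⟩
    rw [← groupRingSum_pow_char 3 (hPQ.pow_injective (by norm_num)),
      hPQ.groupRingSum_image_sq_mul, groupRingSum_union hPQ.disjoint]
    linear_combination (-groupRingSum (ZMod 3) univ) * hadd
      + (-2 * groupRingSum (ZMod 3) univ + 2 * groupRingSum (ZMod 3) P) * hk'
      + ((#P - 2 * k - 2) * groupRingSum (ZMod 3) univ
        + (2 * k + 1) * groupRingSum (ZMod 3) P) * h3
  have hcoef := congrArg (fun x => x.coeff h) key
  simp only [coeff_add, Finsupp.add_apply, hPQ.coeff_groupRingSum_image_sq_mul,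
    coeff_groupRingSum, Finset.mem_univ, if_true] at hcoef
  have hmod (r : ℕ) (hr : r < 3) (hcast : (sqCoef P Q h : ZMod 3) = r) : sqCoef P Q h % 3 = r := by
    rw [ZMod.natCast_eq_natCast_iff'] at hcast
    rw [hcast, Nat.mod_eq_of_lt hr]
  rw [← eq_sub_iff_add_eq] at hcoef
  split_ifs with hU hc hc
  all_goals
    refine hmod _ (by norm_num) ?_
    simp only [hU, hc, if_true, if_false] at hcoef
    rw [hcoef]
    decide

end IsAPLLPair

end APLLPair

namespace IsAPLLPair

open MonoidAlgebra Finset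

variable {H : Type*} [CommGroup H] [Fintype H] {n : ℕ} {P Q : Finset H}

lemma sqCoef_inv (hPQ : IsAPLLPair n P Q) (h : H) : sqCoef P Q h⁻¹ = sqCoef P Q h := by
  refine Finset.card_nbij' (fun p => (p.1⁻¹, p.2⁻¹)) (fun p => (p.1⁻¹, p.2⁻¹)) ?_ ?_ ?_ ?_
  · rintro ⟨a, b⟩ hab
    have hab := Finset.mem_filter.1 hab
    rw [Finset.mem_product] at hab
    refine Finset.mem_filter.2 ⟨Finset.mem_product.2 ⟨?_, hPQ.inv_mem_left _ hab.1.2⟩, ?_⟩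
    · exact hPQ.inv_mem_union hab.1.1
    · rw [← inv_inv h, ← hab.2, mul_inv, inv_pow]
  · rintro ⟨a, b⟩ hab
    have hab := Finset.mem_filter.1 hab
    rw [Finset.mem_product] at hab
    refine Finset.mem_filter.2 ⟨Finset.mem_product.2 ⟨?_, hPQ.inv_mem_left _ hab.1.2⟩, ?_⟩
    · exact hPQ.inv_mem_union hab.1.1
    · rw [← hab.2, mul_inv, inv_pow]
  · rintro ⟨a, b⟩ -
    simp
  · rintro ⟨a, b⟩ -
    simp

lemma sum_sqCoef (P Q : Finset H) : ∑ h, sqCoef P Q h = #(P ∪ Q) * #P := by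
  rw [← Finset.card_product]
  exact (Finset.card_eq_sum_card_fiberwise (fun _ _ => Finset.mem_univ _)).symm

lemma card_union (hPQ : IsAPLLPair n P Q) : #(P ∪ Q) = 2 * n + 1 := by
  rw [Finset.card_union_of_disjoint hPQ.disjoint, hPQ.card_add_card]

lemma one_mem_union (hPQ : IsAPLLPair n P Q) : 1 ∈ P ∪ Q := by
  have h1 := hPQ.card_mul_self_eq 1
  have h2 := hPQ.symm.card_mul_self_eq 1
  have h := hPQ.card_mul_self 1
  rw [h1, h2] at h
  simp only [if_true] at h
  have hadd := hPQ.card_add_card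
  have key (S : Finset H) (hS : 1 ∈ S.image fun t => t ^ 2) : 1 ∈ S := by
    obtain ⟨z, hz, hz1⟩ := Finset.mem_image.1 hS
    rwa [← hPQ.pow_injective (k := 2) (by norm_num) (hz1.trans (one_pow 2).symm)]
  by_contra hmem
  rw [Finset.mem_union, not_or] at hmem
  rw [if_neg fun h => hmem.1 (key P h), if_neg fun h => hmem.2 (key Q h)] at h
  omega

omit [Fintype H] in
lemma image_pow_four (S : Finset H) :
    S.image (fun t => t ^ 4) = (S.image fun t => t ^ 2).image fun t => t ^ 2 := by
  rw [Finset.image_image]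
  exact Finset.image_congr fun t _ => by simp [← pow_mul]

variable {R : Type*} [CommRing R]

lemma groupRingSum_image_sq_union_sq (hPQ : IsAPLLPair n P Q) :
    groupRingSum R ((P ∪ Q).image fun t => t ^ 2) ^ 2
      = 4 * groupRingSum R univ + 2 * (n : MonoidAlgebra R H) - 2
        - groupRingSum R ((P ∪ Q).image fun t => t ^ 4) := by
  have hinj := hPQ.pow_injective (k := 2) (by norm_num)
  have hinj' : Function.Injective (powMonoidHom 2 : H →* H) := hinj
  have himg (S : Finset H) : S.image (powMonoidHom 2 : H →* H) = S.image fun t => t ^ 2 := rfl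
  have h : groupRingSum R (P ∪ Q) ^ 2 = 4 * groupRingSum R univ + 2 * (n : MonoidAlgebra R H) - 2
      - groupRingSum R ((P ∪ Q).image fun t => t ^ 2) := by
    rw [Finset.image_union, groupRingSum_union hPQ.disjoint,
      groupRingSum_union ((Finset.disjoint_image hinj).2 hPQ.disjoint)]
    linear_combination hPQ.groupRingSum_sq_add_sq (R := R)
      + 2 * hPQ.groupRingSum_mul_eq (R := R)
  have hmap := congrArg (mapDomainRingHom R (powMonoidHom 2 : H →* H)) h
  simp only [map_pow, map_sub, map_add, map_mul, map_natCast, map_ofNat,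
    mapDomainRingHom_groupRingSum hinj', himg] at hmap
  rw [hmap, image_pow_four, Finset.image_univ_of_surjective (Finite.surjective_of_injective hinj)]

lemma sum_sqCoef_sq (hPQ : IsAPLLPair n P Q) :
    ∑ h, (sqCoef P Q h : ℚ) ^ 2 = 4 * (#P : ℚ) ^ 2 + (2 * n - 3) * #P
      - #((((P ∪ Q).image fun t => t ^ 4) ∩ P.image fun t => t ^ 2).erase 1)
      - 2 * #((((P ∪ Q).image fun t => t ^ 4) ∩
          ((P * P) \ P.image fun t => t ^ 2)).erase 1) := by
  set U := (P ∪ Q).image fun t => t ^ 4 with hU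
  have hinj := hPQ.pow_injective (k := 2) (by norm_num)
  have h1U : 1 ∈ U := Finset.mem_image.2 ⟨1, hPQ.one_mem_union, one_pow 4⟩
  have hsq : ((groupRingSum ℚ ((P ∪ Q).image fun t => t ^ 2) * groupRingSum ℚ P)
      * (groupRingSum ℚ ((P ∪ Q).image fun t => t ^ 2) * groupRingSum ℚ P)).coeff 1
      = ∑ h, (sqCoef P Q h : ℚ) ^ 2 := by
    rw [coeff_one_mul_eq_sum, Finset.image_union,
      groupRingSum_union ((Finset.disjoint_image hinj).2 hPQ.disjoint)]
    refine Finset.sum_congr rfl fun h _ => ?_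
    rw [hPQ.coeff_groupRingSum_image_sq_mul, hPQ.coeff_groupRingSum_image_sq_mul, hPQ.sqCoef_inv,
      sq]
  have hexp : (groupRingSum ℚ ((P ∪ Q).image fun t => t ^ 2) * groupRingSum ℚ P)
      * (groupRingSum ℚ ((P ∪ Q).image fun t => t ^ 2) * groupRingSum ℚ P)
      = (4 * (#P : ℚ) ^ 2) • groupRingSum ℚ univ
        + (2 * n - 2 : ℚ) • (groupRingSum ℚ P * groupRingSum ℚ P)
        - groupRingSum ℚ U * (groupRingSum ℚ P * groupRingSum ℚ P) := by
    simp only [Algebra.smul_def]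
    simp only [map_mul, map_sub, map_pow, map_natCast, map_ofNat]
    linear_combination groupRingSum ℚ P ^ 2 * hPQ.groupRingSum_image_sq_union_sq (R := ℚ)
      + (4 * groupRingSum ℚ P + 4 * (#P : MonoidAlgebra ℚ H)) * groupRingSum_mul_univ (R := ℚ) P
  rw [← hsq, hexp]
  have hinvU : ∀ x ∈ U, x⁻¹ ∈ U := by
    intro x hx
    obtain ⟨t, ht, rfl⟩ := Finset.mem_image.1 hx
    exact Finset.mem_image.2 ⟨t⁻¹, hPQ.inv_mem_union ht, inv_pow t 4⟩
  have hU4 : (groupRingSum ℚ U * (groupRingSum ℚ P * groupRingSum ℚ P)).coeff 1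
      = #P + #((U ∩ P.image fun t => t ^ 2).erase 1)
        + 2 * #((U ∩ ((P * P) \ P.image fun t => t ^ 2)).erase 1) := by
    have hreindex : ∑ s ∈ U, (groupRingSum ℚ P * groupRingSum ℚ P).coeff s⁻¹
        = ∑ s ∈ U, (groupRingSum ℚ P * groupRingSum ℚ P).coeff s :=
      Finset.sum_nbij' (fun s => s⁻¹) (fun s => s⁻¹) hinvU hinvU (by simp) (by simp) (by simp)
    have hcard (S : Finset H) :
        (#((U ∩ S).erase 1) : ℚ) = ∑ s ∈ U.erase 1, if s ∈ S then 1 else 0 := by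
      rw [Finset.sum_boole, Finset.filter_mem_eq_inter, Finset.erase_inter]
    rw [coeff_one_groupRingSum_mul, hreindex, ← Finset.add_sum_erase U _ h1U, hcard, hcard,
      Finset.mul_sum, add_assoc, ← Finset.sum_add_distrib]
    simp only [coeff_groupRingSum_mul, hPQ.card_mul_self_eq]
    congr 1
    refine Finset.sum_congr rfl fun s hs => ?_
    rw [if_neg (Finset.ne_of_mem_erase hs)]
    push_cast
    rfl
  rw [coeff_sub, coeff_add, coeff_smul, coeff_smul, Finsupp.sub_apply, Finsupp.add_apply,
    Finsupp.smul_apply, Finsupp.smul_apply, hU4, coeff_groupRingSum, coeff_groupRingSum_mul,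
    hPQ.card_mul_self_eq]
  simp
  ring

/-- The level set bounds for the coefficients of `(P⁽²⁾ + Q⁽²⁾) P`. -/
lemma level_set_bounds (hPQ : IsAPLLPair n P Q) {p v m θ K R N₁ : ℚ} (hp : (#P : ℚ) = p)
    (hv : (#((P ∪ Q) ∩ P.image fun t => t ^ 3) : ℚ) = v)
    (hm : (#((((P ∪ Q).image fun t => t ^ 4) ∩ P.image fun t => t ^ 2).erase 1) : ℚ) = m)
    (hθ : (#((((P ∪ Q).image fun t => t ^ 4) ∩
      ((P * P) \ P.image fun t => t ^ 2)).erase 1) : ℚ) = θ)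
    (hN₁ : N₁ = n ^ 2 - n - p + 2 * v)
    (hK : K = (4 * p ^ 2 - (8 * n + 6) * p + 4 * n ^ 2 + 8 * n + 6 - m - 2 * θ) / 2 - 2 * v)
    (hR : R = (2 * n - 1) * p - n ^ 2 - 3 * n - 2 + 3 * v) :
    3 * (({h | sqCoef P Q h = 0} : Set H).ncard : ℚ) ≤ K ∧
    (∑' i : ℕ, if 5 ≤ i then sCoef i * (({h | sqCoef P Q h = i} : Set H).ncard : ℚ) else 0)
      ≤ K ∧
    (R - 2 * K ≤ 3 * (({h | sqCoef P Q h = 4} : Set H).ncard : ℚ) ∧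
      3 * (({h | sqCoef P Q h = 4} : Set H).ncard : ℚ) ≤ R + K) ∧
    (3 * N₁ - R - 2 * K ≤ 3 * (({h | sqCoef P Q h = 1} : Set H).ncard : ℚ) ∧
      3 * (({h | sqCoef P Q h = 1} : Set H).ncard : ℚ) ≤ 3 * N₁ - R + 2 * K) := by
  have hcube : #(P.image fun t => t ^ 3) = #P :=
    Finset.card_image_of_injective _ (hPQ.pow_injective (by norm_num))
  have hS₁ : ∑ h, (sqCoef P Q h : ℚ) = (2 * n + 1) * p := by
    rw [← Nat.cast_sum, sum_sqCoef, hPQ.card_union, ← hp]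
    push_cast
    rfl
  have hN₀ : ∑ h, (if sqCoef P Q h % 3 = 0 then (1 : ℚ) else 0) = p - v := by
    rw [← hp, ← hv, ← hcube, Finset.inter_comm, eq_sub_iff_add_eq,
      ← Finset.card_sdiff_add_card_inter (P.image fun t => t ^ 3) (P ∪ Q), Finset.sum_boole,
      Nat.cast_add]
    congr 3
    ext h
    rw [Finset.mem_filter, hPQ.sqCoef_mod_three, Finset.mem_sdiff]
    split_ifs <;> simp_all
  have hN₂ : ∑ h, (if sqCoef P Q h % 3 = 2 then (1 : ℚ) else 0) = 2 * n + 1 - v := by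
    have hU : (#(P ∪ Q) : ℚ) = 2 * n + 1 := by exact_mod_cast hPQ.card_union
    rw [← hv, ← hU, eq_sub_iff_add_eq,
      ← Finset.card_sdiff_add_card_inter (P ∪ Q) (P.image fun t => t ^ 3), Finset.sum_boole,
      Nat.cast_add]
    congr 3
    ext h
    rw [Finset.mem_filter, hPQ.sqCoef_mod_three, Finset.mem_sdiff]
    split_ifs <;> simp_all
  have hS₂ := hPQ.sum_sqCoef_sq
  rw [hp, hm, hθ] at hS₂
  refine level_set_bounds_of_moments (sqCoef P Q) hS₁ hS₂ hN₀ hN₂ (N₁ := N₁) ?_ ?_ ?_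
  · rw [hN₁, hPQ.card_group]
    push_cast
    ring
  · rw [hK, hPQ.card_group]
    push_cast
    ring
  · rw [hR, hN₁]
    ring

lemma card_image_pow_four_inter (hPQ : IsAPLLPair n P Q) :
    #((((P ∪ Q).image fun t => t ^ 4) ∩ P.image fun t => t ^ 2).erase 1)
      = #((P ∩ (P ∪ Q).image fun t => t ^ 2).erase 1) := by
  have hinj := hPQ.pow_injective (k := 2) (by norm_num)
  rw [image_pow_four, ← Finset.image_inter _ _ hinj, Finset.inter_comm]
  nth_rw 1 [← one_pow (M := H) 2]
  rw [← Finset.image_erase hinj, Finset.card_image_of_injective _ hinj]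

lemma card_mul_card (hPQ : IsAPLLPair n P Q) : #P * #Q = n ^ 2 + n := by
  rw [← Finset.card_product, Finset.card_eq_sum_card_fiberwise (f := fun p : H × H => p.1 * p.2)
    (t := Finset.univ) fun _ _ => Finset.mem_univ _]
  simp only [hPQ.card_mul]
  rw [← Finset.add_sum_erase _ _ (Finset.mem_univ 1), if_pos rfl,
    Finset.sum_congr rfl fun h hh => if_neg (Finset.ne_of_mem_erase hh)]
  simp [hPQ.card_group]

lemma even_card_right (hPQ : IsAPLLPair n P Q) (h1 : 1 ∈ P) : Even #Q := by
  have : ∑ _p ∈ Q, (1 : ZMod 2) = 0 := by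
    refine Finset.sum_involution (fun p _ => p⁻¹) (fun _ _ => CharTwo.add_self_eq_zero 1) ?_
      (fun x hx => hPQ.inv_mem_right x hx) (fun _ _ => inv_inv _)
    rintro x hx - hinv
    have hx1 : x = 1 := by
      refine hPQ.pow_injective (k := 2) (by norm_num) ?_
      change x ^ 2 = 1 ^ 2
      rw [sq, one_pow, mul_eq_one_iff_eq_inv]
      exact hinv.symm
    exact Finset.disjoint_left.1 hPQ.disjoint h1 (hx1 ▸ hx)
  rwa [Finset.sum_const, nsmul_eq_mul, mul_one, ZMod.natCast_eq_zero_iff_even] at this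

lemma card_left (hPQ : IsAPLLPair n P Q) (h1 : 1 ∈ P) : #P = n + 1 := by
  obtain ⟨k, hk⟩ := hPQ.even_card_right h1
  have hmul := hPQ.card_mul_card
  have hadd := hPQ.card_add_card
  have hmod := hPQ.mod_six
  have h0 : ((#P : ℤ) - (n + 1)) * (#P - n) = 0 := by
    have hq : (#Q : ℤ) = 2 * n + 1 - #P := by omega
    have hmul' : (#P : ℤ) * #Q = n ^ 2 + n := by exact_mod_cast hmul
    rw [hq] at hmul'
    linear_combination -hmul'
  rcases mul_eq_zero.1 h0 with h | h <;> omega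

lemma inter_image_sq_left (hPQ : IsAPLLPair n P Q) (h1 : 1 ∈ P) :
    (P ∩ (P ∪ Q).image fun t => t ^ 2).erase 1 = ∅ := by
  rw [Finset.eq_empty_iff_forall_notMem]
  intro x hx
  rw [Finset.mem_erase, Finset.mem_inter] at hx
  obtain ⟨y, hy, hyx⟩ := Finset.mem_image.1 hx.2.2
  exact hx.1 (hPQ.eq_one_of_eq_sq h1 hx.2.1 hy hyx.symm)

lemma inter_image_cube_left (hPQ : IsAPLLPair n P Q) (h1 : 1 ∈ P) :
    P ∩ P.image (fun t => t ^ 3) = {1} := by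
  ext x
  rw [Finset.mem_inter, Finset.mem_singleton]
  constructor
  · rintro ⟨hx, hx'⟩
    obtain ⟨y, hy, hyx⟩ := Finset.mem_image.1 hx'
    exact hPQ.eq_one_of_eq_cube hx hy hyx.symm
  · rintro rfl
    exact ⟨h1, Finset.mem_image.2 ⟨1, h1, one_pow 3⟩⟩

lemma card_union_inter (hPQ : IsAPLLPair n P Q) (S : Finset H) :
    #((P ∪ Q) ∩ S) = #(P ∩ S) + #(Q ∩ S) := by
  rw [Finset.union_inter_distrib_right, Finset.card_union_of_disjoint]
  exact hPQ.disjoint.mono Finset.inter_subset_left Finset.inter_subset_left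

omit [Fintype H] in
lemma theta0_coe (P Q : Finset H) : theta0 (P : Set H) Q
    = #(((P * P) \ P.image fun t => t ^ 2) ∩ (P ∪ Q).image fun t => t ^ 4) := by
  rw [theta0, ← Set.ncard_coe_finset]
  push_cast
  rfl

omit [Fintype H] in
lemma theta1_coe (P Q : Finset H) : theta1 (P : Set H) Q
    = (#(Q ∩ (P ∪ Q).image fun t => t ^ 2) : ℚ) / 2
      + #(((Q * Q) \ (Q.image (fun t => t ^ 2) ∪ {1})) ∩ (P ∪ Q).image fun t => t ^ 4) := by
  rw [theta1, ← Set.ncard_coe_finset, ← Set.ncard_coe_finset]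
  push_cast
  rfl

omit [Fintype H] in
lemma Xset_coe (P Q : Finset H) (i : ℕ) :
    Xset (P : Set H) Q i = {h | sqCoef P Q h = i} := by
  refine congrArg _ (funext fun h => ?_)
  rw [sqCoef, ← Set.ncard_coe_finset]
  congr 2
  ext p
  simp [or_and_right, and_assoc]

omit [Fintype H] in
lemma Yset_coe (P Q : Finset H) (i : ℕ) :
    Yset (P : Set H) Q i = {h | sqCoef Q P h = i} := by
  rw [← Xset_coe, Xset, Yset, Set.union_comm]

end IsAPLLPair

/-- The symmetric form of the hypotheses on a pair satisfying `APLLEqs`. -/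
lemma isAPLLPair_of_coe {H : Type*} [CommGroup H] [Fintype H] {n : ℕ} {P Q : Finset H}
    (hmod : n % 6 = 2) (hcard : Fintype.card H = n ^ 2 + n + 1)
    (hP : (P : Set H)⁻¹ = P) (hQ : (Q : Set H)⁻¹ = Q) (hk : P.card + Q.card = 2 * n + 1)
    (h : APLLEqs n (P : Set H) Q) : IsAPLLPair n P Q := by
  have hinv (S : Finset H) (hS : (S : Set H)⁻¹ = S) (x : H) (hx : x ∈ S) : x⁻¹ ∈ S := by
    rw [← Finset.mem_coe, ← Set.mem_inv, hS]
    exact hx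
  have hcop : (Nat.card H).Coprime 2 := by
    have hparity : Odd (n ^ 2 + n + 1) := by
      rw [show n ^ 2 + n + 1 = n * (n + 1) + 1 by ring]
      exact (Nat.even_mul_succ_self n).add_one
    rw [Nat.card_eq_fintype_card, hcard]
    exact Nat.coprime_two_right.2 hparity
  have hprod (S T : Finset H) (x : H) :
      {p : H × H | p.1 ∈ (S : Set H) ∧ p.2 ∈ (T : Set H) ∧ p.1 * p.2 = x}.ncard
        = ({p ∈ S ×ˢ T | p.1 * p.2 = x} : Finset (H × H)).card := by
    rw [← Set.ncard_coe_finset]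
    congr 1
    ext p
    simp [and_assoc]
  have hsq (S : Finset H) (x : H) : {t : H | t ∈ (S : Set H) ∧ t ^ 2 = x}.ncard
      = if x ∈ S.image (fun t => t ^ 2) then 1 else 0 := by
    split_ifs with hx
    · obtain ⟨t, ht, rfl⟩ := Finset.mem_image.1 hx
      rw [Set.ncard_eq_one]
      refine ⟨t, Set.ext fun s => ⟨fun hs => hcop.pow_left_bijective.injective hs.2, ?_⟩⟩
      rintro rfl
      exact ⟨ht, rfl⟩
    · rw [Set.ncard_eq_zero, Set.eq_empty_iff_forall_notMem]
      exact fun t ht => hx (Finset.mem_image.2 ⟨t, ht⟩)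
  refine ⟨hmod, hcard, hk, hinv P hP, hinv Q hQ, fun x => ?_, fun x => ?_⟩
  · rw [← hprod, h.1]
  · rw [← hprod, ← hprod, ← hsq, ← hsq, h.2]

/-- For `n ≡ 2 (mod 6)`, bounds on `|X₀|`, `|Y₀|`, `Σ_{i≥5} s_i|X_i|`,
`Σ_{i≥5} s_i|Y_i|`, `|X₁|`, `|X₄|`, `|Y₁|` and `|Y₄|` in terms of
`ℓ₀ = |T₁ ∩ T₀⁽³⁾|`, `u = |T₀ ∩ T₁⁽³⁾| + |T₁ ∩ T₁⁽³⁾|`, `θ₀` and `θ₁`, as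
inequalities of rational numbers. -/
theorem Xi_Yi_bounds_n_eq_two_mod_six (n : ℕ) (hn : 0 < n) (hmod : n % 6 = 2)
    {H : Type*} [CommGroup H] [Fintype H]
    (hcard : Fintype.card H = n ^ 2 + n + 1)
    (T₀ T₁ : Set H) (hT₀inv : T₀⁻¹ = T₀) (hT₁inv : T₁⁻¹ = T₁)
    (he : (1 : H) ∈ T₀) (hk : T₀.ncard + T₁.ncard = 2 * n + 1)
    (hAPLL : APLLEqs n T₀ T₁)
    (ℓ₀ u : ℕ) (hℓ₀ : ℓ₀ = (T₁ ∩ ((fun t => t ^ 3) '' T₀)).ncard)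
    (hu : u = (T₀ ∩ ((fun t => t ^ 3) '' T₁)).ncard
        + (T₁ ∩ ((fun t => t ^ 3) '' T₁)).ncard) :
    3 * ((Xset T₀ T₁ 0).ncard : ℚ) ≤ (n : ℚ) - 2 * ℓ₀ - theta0 T₀ T₁ ∧
    (∑' i : ℕ, if 5 ≤ i then sCoef i * ((Xset T₀ T₁ i).ncard : ℚ) else 0)
      ≤ (n : ℚ) - 2 * ℓ₀ - theta0 T₀ T₁ ∧
    3 * ((Yset T₀ T₁ 0).ncard : ℚ) ≤ (n : ℚ) - 2 * u + 3 - theta1 T₀ T₁ ∧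
    (∑' i : ℕ, if 5 ≤ i then sCoef i * ((Yset T₀ T₁ i).ncard : ℚ) else 0)
      ≤ (n : ℚ) - 2 * u + 3 - theta1 T₀ T₁ ∧
    ((n : ℚ) ^ 2 - 4 * n + 7 * ℓ₀ + 2 * theta0 T₀ T₁
        ≤ 3 * ((Xset T₀ T₁ 4).ncard : ℚ) ∧
      3 * ((Xset T₀ T₁ 4).ncard : ℚ)
        ≤ (n : ℚ) ^ 2 - n + ℓ₀ - theta0 T₀ T₁) ∧
    (2 * (n : ℚ) ^ 2 - 6 * n + 7 * ℓ₀ + 3 + 2 * theta0 T₀ T₁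
        ≤ 3 * ((Xset T₀ T₁ 1).ncard : ℚ) ∧
      3 * ((Xset T₀ T₁ 1).ncard : ℚ)
        ≤ 2 * (n : ℚ) ^ 2 - 2 * n - ℓ₀ + 3 - 2 * theta0 T₀ T₁) ∧
    ((n : ℚ) ^ 2 - 6 * n + 7 * u - 8 + 2 * theta1 T₀ T₁
        ≤ 3 * ((Yset T₀ T₁ 4).ncard : ℚ) ∧
      3 * ((Yset T₀ T₁ 4).ncard : ℚ)
        ≤ (n : ℚ) ^ 2 - 3 * n + u + 1 - theta1 T₀ T₁) ∧
    (2 * (n : ℚ) ^ 2 - 4 * n + 7 * u - 4 + 2 * theta1 T₀ T₁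
        ≤ 3 * ((Yset T₀ T₁ 1).ncard : ℚ) ∧
      3 * ((Yset T₀ T₁ 1).ncard : ℚ)
        ≤ 2 * (n : ℚ) ^ 2 - u + 8 - 2 * theta1 T₀ T₁) := by
  lift T₀ to Finset H using T₀.toFinite
  lift T₁ to Finset H using T₁.toFinite
  rw [Set.ncard_coe_finset, Set.ncard_coe_finset] at hk
  rw [Finset.mem_coe] at he
  have hPQ := isAPLLPair_of_coe hmod hcard hT₀inv hT₁inv hk hAPLL
  have h1T₁ : (1 : H) ∉ T₁ := Finset.disjoint_left.1 hPQ.disjoint he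
  have hp : (T₀.card : ℚ) = n + 1 := by exact_mod_cast hPQ.card_left he
  have hq : (T₁.card : ℚ) = n := by
    have : (T₀.card : ℚ) + T₁.card = 2 * n + 1 := by exact_mod_cast hk
    linarith
  have hℓ : (((T₀ ∪ T₁) ∩ T₀.image fun t => t ^ 3).card : ℚ) = 1 + ℓ₀ := by
    rw [hPQ.card_union_inter, hPQ.inter_image_cube_left he, hℓ₀, ← Set.ncard_coe_finset (T₁ ∩ _)]
    push_cast
    rw [Finset.card_singleton, Nat.cast_one]
  have hu' : (((T₁ ∪ T₀) ∩ T₁.image fun t => t ^ 3).card : ℚ) = u := by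
    rw [hPQ.symm.card_union_inter, hu, add_comm, ← Set.ncard_coe_finset, ← Set.ncard_coe_finset]
    push_cast
    rfl
  have hm₀ := hPQ.card_image_pow_four_inter
  rw [hPQ.inter_image_sq_left he, Finset.card_empty] at hm₀
  have hθ₀ : ((((T₀ ∪ T₁).image fun t => t ^ 4) ∩
      ((T₀ * T₀) \ T₀.image fun t => t ^ 2)).erase 1).card = theta0 (T₀ : Set H) T₁ := by
    have h1 : (1 : H) ∈ T₀.image fun t => t ^ 2 := Finset.mem_image.2 ⟨1, he, one_pow 2⟩
    rw [IsAPLLPair.theta0_coe, Finset.inter_comm, Finset.erase_eq_of_notMem]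
    simp only [Finset.mem_inter, Finset.mem_sdiff, h1, not_true, and_false, false_and,
      not_false_eq_true]
  have hm₁ := hPQ.symm.card_image_pow_four_inter
  rw [Finset.erase_eq_of_notMem (s := T₁ ∩ _) fun h => h1T₁ (Finset.mem_inter.1 h).1] at hm₁
  have hθ₁ : ((((T₁ ∪ T₀).image fun t => t ^ 4) ∩
      ((T₁ * T₁) \ T₁.image fun t => t ^ 2)).erase 1).card
      = (((T₁ * T₁) \ (T₁.image (fun t => t ^ 2) ∪ {1})) ∩
        (T₀ ∪ T₁).image fun t => t ^ 4).card := by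
    rw [Finset.union_comm T₁ T₀]
    congr 1
    ext x
    simp only [Finset.mem_erase, Finset.mem_inter, Finset.mem_sdiff, Finset.mem_union,
      Finset.mem_singleton]
    tauto
  have hX := hPQ.level_set_bounds hp hℓ (congrArg Nat.cast hm₀) (congrArg Nat.cast hθ₀) rfl rfl rfl
  have hY := hPQ.symm.level_set_bounds hq hu' (congrArg Nat.cast hm₁) (congrArg Nat.cast hθ₁)
    rfl rfl rfl
  simp only [IsAPLLPair.Xset_coe, IsAPLLPair.Yset_coe, IsAPLLPair.theta1_coe]
  rw [Finset.union_comm T₁ T₀] at hY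
  obtain ⟨hX₀, hX₅, ⟨hX₄, hX₄'⟩, hX₁, hX₁'⟩ := hX
  obtain ⟨hY₀, hY₅, ⟨hY₄, hY₄'⟩, hY₁, hY₁'⟩ := hY
  have hX₀' : (0 : ℚ) ≤ (({h | IsAPLLPair.sqCoef T₀ T₁ h = 0} : Set H).ncard : ℚ) :=
    Nat.cast_nonneg _
  have hY₀' : (0 : ℚ) ≤ (({h | IsAPLLPair.sqCoef T₁ T₀ h = 0} : Set H).ncard : ℚ) :=
    Nat.cast_nonneg _
  push_cast at hX₀ hX₅ hX₄ hX₄' hX₁ hX₁'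
  refine ⟨?_, ?_, ?_, ?_, ⟨?_, ?_⟩, ⟨?_, ?_⟩, ⟨?_, ?_⟩, ?_, ?_⟩ <;> linarith
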